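/- Let 0 < p ≤ 1, let t be a positive integer, and let a_1 ≥ a_2 ≥ … ≥ 0 be a nonincreasing sequence of nonnegative reals with only finitely many nonzero terms. Then Σ_{k ≥ 1} ( Σ_{i = kt+1}^{(k+1)t} a_i² )^{1/2} ≤ t^{1/2 − 1/p} · ( Σ_{i ≥ 1} a_i^p )^{1/p}. -/

import Mathlib

/-- Blocking inequality for nonincreasing sequences: for a nonincreasing finitely-supported
sequence `a₀ ≥ a₁ ≥ … ≥ 0` (0-indexed) and blocks of length `t`, the sum over `k ≥ 1` of
the `ℓ₂`-norms of the blocks `(a_{kt}, …, a_{(k+1)t - 1})` is at most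
`t^{1/2 - 1/p}` times the `ℓ_p`-quasi-norm of the whole sequence. -/
theorem blocking_inequality (p : ℝ) (hp0 : 0 < p) (hp1 : p ≤ 1)
    (t : ℕ) (ht : 0 < t) (a : ℕ → ℝ)
    (ha0 : ∀ i, 0 ≤ a i) (hmono : Antitone a)
    (hfin : (Function.support a).Finite) :
    ∑' k : ℕ, Real.sqrt (∑ i ∈ Finset.Ico ((k + 1) * t) ((k + 2) * t), a i ^ 2) ≤
      (t : ℝ) ^ ((1 : ℝ) / 2 - 1 / p) * (∑' i : ℕ, a i ^ p) ^ (1 / p) := by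
  have hq : 1 ≤ 1 / p := by rw [le_div_iff₀ hp0]; linarith
  have htR : (0 : ℝ) < t := by exact_mod_cast ht
  have hS0 : ∀ s : Finset ℕ, 0 ≤ ∑ i ∈ s, a i ^ p :=
    fun s => Finset.sum_nonneg fun i _ => Real.rpow_nonneg (ha0 i) p
  have hblock : ∀ k : ℕ, Real.sqrt (∑ i ∈ Finset.Ico ((k + 1) * t) ((k + 2) * t), a i ^ 2) ≤
      (t : ℝ) ^ ((1 : ℝ) / 2 - 1 / p) *
        (∑ i ∈ Finset.Ico (k * t) ((k + 1) * t), a i ^ p) ^ (1 / p) := by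
    intro k
    set m := a ((k + 1) * t) with hm
    have hm0 : 0 ≤ m := ha0 _
    have h1 : ∑ i ∈ Finset.Ico ((k + 1) * t) ((k + 2) * t), a i ^ 2 ≤ t * m ^ 2 := by
      have h := Finset.sum_le_card_nsmul (Finset.Ico ((k + 1) * t) ((k + 2) * t))
        (fun i => a i ^ 2) (m ^ 2) (fun i hi => by
          have := hmono (Finset.mem_Ico.1 hi).1
          exact pow_le_pow_left₀ (ha0 i) this 2)
      have hc : (k + 2) * t - (k + 1) * t = t := by
        rw [← Nat.sub_mul]; simp
      rw [Nat.card_Ico, hc, nsmul_eq_mul] at h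
      exact h
    have h2 : t * m ^ p ≤ ∑ i ∈ Finset.Ico (k * t) ((k + 1) * t), a i ^ p := by
      have h := Finset.card_nsmul_le_sum (Finset.Ico (k * t) ((k + 1) * t))
        (fun i => a i ^ p) (m ^ p) (fun i hi => by
          have := hmono (Finset.mem_Ico.1 hi).2.le
          exact Real.rpow_le_rpow hm0 this hp0.le)
      have hc : (k + 1) * t - k * t = t := by
        rw [← Nat.sub_mul]; simp
      rw [Nat.card_Ico, hc, nsmul_eq_mul] at h
      exact h
    calc Real.sqrt (∑ i ∈ Finset.Ico ((k + 1) * t) ((k + 2) * t), a i ^ 2)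
        ≤ Real.sqrt (t * m ^ 2) := Real.sqrt_le_sqrt h1
      _ = (t : ℝ) ^ ((1 : ℝ) / 2) * m := by
        rw [Real.sqrt_mul htR.le, Real.sqrt_sq hm0, Real.sqrt_eq_rpow]
      _ = (t : ℝ) ^ ((1 : ℝ) / 2 - 1 / p) * (t * m ^ p) ^ (1 / p) := by
        rw [Real.mul_rpow htR.le (Real.rpow_nonneg hm0 p), ← mul_assoc, ← Real.rpow_add htR,
          ← Real.rpow_mul hm0, mul_one_div_cancel hp0.ne', Real.rpow_one, sub_add_cancel]
      _ ≤ _ := by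
        apply mul_le_mul_of_nonneg_left _ (Real.rpow_nonneg htR.le _)
        exact Real.rpow_le_rpow (by positivity) h2 (by positivity)
  have hind : ∀ N : ℕ, ∑ k ∈ Finset.range N,
      Real.sqrt (∑ i ∈ Finset.Ico ((k + 1) * t) ((k + 2) * t), a i ^ 2) ≤
      (t : ℝ) ^ ((1 : ℝ) / 2 - 1 / p) * (∑ i ∈ Finset.range (N * t), a i ^ p) ^ (1 / p) := by
    intro N
    induction N with
    | zero =>
      simp only [Finset.range_zero, Finset.sum_empty, zero_mul]
      positivity
    | succ N ih =>
      rw [Finset.sum_range_succ, ← Finset.sum_range_add_sum_Ico (fun i => a i ^ p)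
        (Nat.mul_le_mul_right t (Nat.le_succ N))]
      refine (add_le_add ih (hblock N)).trans ?_
      rw [← mul_add]
      apply mul_le_mul_of_nonneg_left _ (Real.rpow_nonneg htR.le _)
      exact Real.add_rpow_le_rpow_add (hS0 _) (hS0 _) hq
  obtain ⟨M, hM⟩ := hfin.bddAbove
  have hz : ∀ i, M < i → a i = 0 := by
    intro i hi
    by_contra h
    exact absurd (hM h) (not_le.2 hi)
  have hk : ∀ k, M < k → ∀ j, k * t ≤ j → M < j := fun k hk j hj =>
    lt_of_lt_of_le hk ((Nat.le_mul_of_pos_right k ht).trans hj)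
  rw [tsum_eq_sum (s := Finset.range (M + 1)), tsum_eq_sum (s := Finset.range ((M + 1) * t))]
  · exact hind (M + 1)
  · intro i hi
    rw [Finset.mem_range, not_lt] at hi
    rw [hz i (hk (M + 1) (Nat.lt_succ_self M) i hi), Real.zero_rpow hp0.ne']
  · intro k hk'
    rw [Finset.mem_range, not_lt] at hk'
    rw [Finset.sum_eq_zero, Real.sqrt_zero]
    intro i hi
    rw [hz i (hk (k + 1) (by omega) i (Finset.mem_Ico.1 hi).1)]
    norm_num
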